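/- For every real μ > 0 and all α, β ∈ {↑,↓}: Π(μ)ᵀ · w_{αβ}(μ) = 0. (The adjoint of the local Hamiltonian term annihilates the two-site support space of the left ground state, which is built from the transposed tensors.) -/

import Mathlib

open Matrix Kronecker

/-- The spin-1 operator `Sᶻ` in the basis `(|+1⟩, |0⟩, |−1⟩)`. -/
def spinZ : Matrix (Fin 3) (Fin 3) ℝ := !![1, 0, 0; 0, 0, 0; 0, 0, -1]

/-- The spin-1 raising operator `S⁺` in the basis `(|+1⟩, |0⟩, |−1⟩)`. -/
noncomputable def spinP : Matrix (Fin 3) (Fin 3) ℝ :=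
  !![0, Real.sqrt 2, 0; 0, 0, Real.sqrt 2; 0, 0, 0]

/-- The spin-1 lowering operator `S⁻ = (S⁺)ᵀ`. -/
noncomputable def spinM : Matrix (Fin 3) (Fin 3) ℝ := spinPᵀ

/-- `S^{+z} = S⁺Sᶻ + SᶻS⁺`. -/
noncomputable def spinPZ : Matrix (Fin 3) (Fin 3) ℝ := spinP * spinZ + spinZ * spinP

/-- `S^{−z} = S⁻Sᶻ + SᶻS⁻`. -/
noncomputable def spinMZ : Matrix (Fin 3) (Fin 3) ℝ := spinM * spinZ + spinZ * spinM

/-- The two-site local Hamiltonian term `Π(μ)` on `ℝ³ ⊗ ℝ³` (a 9×9 real matrix). -/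
noncomputable def projPi (μ : ℝ) : Matrix (Fin 3 × Fin 3) (Fin 3 × Fin 3) ℝ :=
  (5/12 : ℝ) • ((μ/2) • (spinM ⊗ₖ spinP) + (1/(2*μ)) • (spinP ⊗ₖ spinM) + spinZ ⊗ₖ spinZ)
  + (2/3 : ℝ) • ((1 : Matrix (Fin 3) (Fin 3) ℝ) ⊗ₖ (1 : Matrix (Fin 3) (Fin 3) ℝ))
  + (1/6 : ℝ) • ((μ^2/4) • ((spinM^2) ⊗ₖ (spinP^2)) + (1/(4*μ^2)) • ((spinP^2) ⊗ₖ (spinM^2))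
      - (spinZ^2) ⊗ₖ (1 : Matrix (Fin 3) (Fin 3) ℝ)
      - (1 : Matrix (Fin 3) (Fin 3) ℝ) ⊗ₖ (spinZ^2))
  + (1/24 : ℝ) • (μ • (spinMZ ⊗ₖ spinPZ) + (1/μ) • (spinPZ ⊗ₖ spinMZ))
  + (1/4 : ℝ) • ((spinZ^2) ⊗ₖ (spinZ^2))

/-- Local tensors of the asymmetric AKLT state: physical index `0 ↦ +1`,
`1 ↦ 0`, `2 ↦ −1`; virtual index `0 ↦ ↑`, `1 ↦ ↓`. -/
noncomputable def asymA (μ : ℝ) : Fin 3 → Matrix (Fin 2) (Fin 2) ℝ :=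
  ![!![0, 0; -Real.sqrt μ, 0],
    !![1 / Real.sqrt 2, 0; 0, -μ / Real.sqrt 2],
    !![0, Real.sqrt μ; 0, 0]]

/-- The two-site blocked vectors of the left ground state,
`w_{αβ}(μ)[i,j] = ((A_μ^{[i]})ᵀ (A_μ^{[j]})ᵀ)_{αβ} = (A_μ^{[j]} A_μ^{[i]})_{βα}`. -/
noncomputable def blockedVecL (μ : ℝ) (p : Fin 2 × Fin 2) : Fin 3 × Fin 3 → ℝ :=
  fun q => ((asymA μ q.1)ᵀ * (asymA μ q.2)ᵀ) p.1 p.2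

theorem spinM_eq : spinM = !![0, 0, 0; Real.sqrt 2, 0, 0; 0, Real.sqrt 2, 0] := by
  ext i j; fin_cases i <;> fin_cases j <;> simp [spinM, spinP]

theorem spinP_sq : spinP ^ 2 = !![0, 0, 2; 0, 0, 0; 0, 0, 0] := by
  ext i j; fin_cases i <;> fin_cases j <;> simp [spinP, pow_two, Matrix.mul_apply, Fin.sum_univ_three]

theorem spinM_sq : spinM ^ 2 = !![0, 0, 0; 0, 0, 0; 2, 0, 0] := by
  ext i j; fin_cases i <;> fin_cases j <;> simp [spinM_eq, pow_two, Matrix.mul_apply, Fin.sum_univ_three]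

theorem spinZ_sq : spinZ ^ 2 = !![1, 0, 0; 0, 0, 0; 0, 0, 1] := by
  ext i j; fin_cases i <;> fin_cases j <;> simp [spinZ, pow_two, Matrix.mul_apply, Fin.sum_univ_three]

theorem spinPZ_eq : spinPZ = !![0, Real.sqrt 2, 0; 0, 0, -Real.sqrt 2; 0, 0, 0] := by
  ext i j; fin_cases i <;> fin_cases j <;>
    simp [spinPZ, spinP, spinZ, Matrix.mul_apply, Fin.sum_univ_three]

theorem spinMZ_eq : spinMZ = !![0, 0, 0; Real.sqrt 2, 0, 0; 0, -Real.sqrt 2, 0] := by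
  ext i j; fin_cases i <;> fin_cases j <;>
    simp [spinMZ, spinM_eq, spinZ, Matrix.mul_apply, Fin.sum_univ_three]

set_option maxHeartbeats 4000000 in
/-- for every `μ > 0` and all `α, β ∈ {↑,↓}`, `Π(μ)ᵀ · w_{αβ}(μ) = 0`:
the adjoint of the local Hamiltonian term annihilates the two-site support space
of the left ground state, built from the transposed tensors. -/
theorem stmt13 (μ : ℝ) (hμ : 0 < μ) (p : Fin 2 × Fin 2) :
    (projPi μ)ᵀ.mulVec (blockedVecL μ p) = 0 := by
  have h2 : Real.sqrt 2 * Real.sqrt 2 = 2 := Real.mul_self_sqrt (by norm_num)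
  have h2p : Real.sqrt 2 ^ 2 = 2 := Real.sq_sqrt (by norm_num)
  have h20 : Real.sqrt 2 ≠ 0 := by positivity
  have hm : Real.sqrt μ * Real.sqrt μ = μ := Real.mul_self_sqrt hμ.le
  have hmp : Real.sqrt μ ^ 2 = μ := Real.sq_sqrt hμ.le
  have hμ0 : μ ≠ 0 := hμ.ne'
  obtain ⟨a, b⟩ := p
  ext ⟨i, j⟩
  simp only [projPi, spinP_sq, spinM_sq, spinZ_sq, spinPZ_eq, spinMZ_eq]
  simp only [spinM_eq]
  fin_cases a <;> fin_cases b <;> fin_cases i <;> fin_cases j <;>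
    simp [Matrix.mulVec, dotProduct, Fintype.sum_prod_type, Fin.sum_univ_three, blockedVecL,
      asymA, spinP, spinZ, Matrix.mul_apply, Fin.sum_univ_two, Matrix.one_apply, h2, hm] <;>
    field_simp <;> ring_nf <;> simp only [h2p, hmp] <;> ring_nf
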